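/- Let F be any field and W any F-vector space. There do not exist vectors m_1, …, m_12 ∈ W such that m_1, m_2, m_3, m_4 are linearly independent and: m_5 ∈ span{m_1, m_2}; m_7 ∈ span{m_3, m_4}; m_8 ∈ span{m_3, m_4}; m_9 ∈ span{m_1, m_7}; m_10 ∈ span{m_7, m_9}; m_6 ∈ span{m_2, m_9}; m_11 ∈ span{m_6, m_9}; m_12 ∈ span{m_10, m_11}; m_1 ∈ span{m_5, m_6}, m_1 ∈ span{m_5, m_9}, m_1 ∈ span{m_5, m_10}; m_2 ∈ span{m_5, m_6}, m_2 ∈ span{m_5, m_11}, m_2 ∈ span{m_5, m_12}; m_3 ∈ span{m_7, m_8}, m_3 ∈ span{m_8, m_9}, m_3 ∈ span{m_8, m_11}; m_4 ∈ span{m_7, m_8}, m_4 ∈ span{m_8, m_10}, m_4 ∈ span{m_8, m_12}. (This is precisely the statement that the network of Fig. 5, constructed from the discrete polymatroid represented by the subspaces in equation (1), admits no scalar linear solution over any field, even though it has a 2-dimensional vector linear solution over F_2.) -/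

import Mathlib

open Submodule

section

variable {F W : Type*} [Field F] [AddCommGroup W] [Module F W]

/-- Two linearly independent vectors do not lie on a common line. -/
theorem LinearIndependent.notMem_span_singleton_of_pair {x y w : W}
    (h : LinearIndependent F ![x, y]) (hx : x ∈ span F {w}) : y ∉ span F {w} := by
  intro hy
  obtain ⟨a, rfl⟩ := mem_span_singleton.mp hx
  obtain ⟨b, rfl⟩ := mem_span_singleton.mp hy
  have hab := LinearIndependent.pair_iff.mp h b (-a) (by module)
  have ha : a = 0 := neg_eq_zero.mp hab.2
  exact h.ne_zero 0 (by simp [ha])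

/-- If `y` together with `v ∈ V` spans a vector of `V` outside the line of `v`, then `y ∈ V`. -/
theorem Submodule.mem_of_mem_span_pair_of_notMem {V : Submodule F W} {v x y : W}
    (hv : v ∈ V) (hx : x ∈ V) (hxy : x ∈ span F {v, y}) (hxv : x ∉ span F {v}) : y ∈ V := by
  obtain ⟨p, q, rfl⟩ := mem_span_pair.mp hxy
  have hq : q ≠ 0 := by
    rintro rfl
    exact hxv (mem_span_singleton.mpr ⟨p, by simp⟩)
  exact (V.smul_mem_iff hq).mp ((V.add_mem_iff_right (V.smul_mem p hv)).mp hx)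

/-- A vector of `V` is of no help in spanning vectors of a subspace disjoint from `V`. -/
theorem Submodule.mem_span_singleton_of_mem_span_pair_of_disjoint {U V : Submodule F W}
    (hUV : Disjoint U V) {u x y : W} (hu : u ∈ U) (hx : x ∈ U) (hy : y ∈ V)
    (hxy : x ∈ span F {u, y}) : x ∈ span F {u} := by
  obtain ⟨s, t, rfl⟩ := mem_span_pair.mp hxy
  have hty : t • y = 0 := disjoint_def.mp hUV _
    ((U.add_mem_iff_right (U.smul_mem s hu)).mp hx) (V.smul_mem t hy)
  exact mem_span_singleton.mpr ⟨s, by simp [hty]⟩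

end

/-- **The network of Fig. 5 has no scalar linear solution over any field (Lemma 3).**
Over any field `F` and `F`-vector space `W`, there are no global encoding vectors
`m₁, …, m₁₂` with `m₁, m₂, m₃, m₄` (the messages) linearly independent such that each
coded edge's vector lies in the span of its inputs and every sink can decode its demand. -/
theorem fig5_network_no_scalar_linear_solution (F W : Type*) [Field F]
    [AddCommGroup W] [Module F W] :
    ¬ ∃ m₁ m₂ m₃ m₄ m₅ m₆ m₇ m₈ m₉ m₁₀ m₁₁ m₁₂ : W,
      LinearIndependent F ![m₁, m₂, m₃, m₄] ∧
      m₅ ∈ Submodule.span F {m₁, m₂} ∧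
      m₇ ∈ Submodule.span F {m₃, m₄} ∧
      m₈ ∈ Submodule.span F {m₃, m₄} ∧
      m₉ ∈ Submodule.span F {m₁, m₇} ∧
      m₁₀ ∈ Submodule.span F {m₇, m₉} ∧
      m₆ ∈ Submodule.span F {m₂, m₉} ∧
      m₁₁ ∈ Submodule.span F {m₆, m₉} ∧
      m₁₂ ∈ Submodule.span F {m₁₀, m₁₁} ∧
      m₁ ∈ Submodule.span F {m₅, m₆} ∧
      m₁ ∈ Submodule.span F {m₅, m₉} ∧
      m₁ ∈ Submodule.span F {m₅, m₁₀} ∧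
      m₂ ∈ Submodule.span F {m₅, m₆} ∧
      m₂ ∈ Submodule.span F {m₅, m₁₁} ∧
      m₂ ∈ Submodule.span F {m₅, m₁₂} ∧
      m₃ ∈ Submodule.span F {m₇, m₈} ∧
      m₃ ∈ Submodule.span F {m₈, m₉} ∧
      m₃ ∈ Submodule.span F {m₈, m₁₁} ∧
      m₄ ∈ Submodule.span F {m₇, m₈} ∧
      m₄ ∈ Submodule.span F {m₈, m₁₀} ∧
      m₄ ∈ Submodule.span F {m₈, m₁₂} := by
  rintro ⟨m₁, m₂, m₃, m₄, m₅, m₆, m₇, m₈, m₉, m₁₀, m₁₁, m₁₂, hli, h5, -, h8, -, -, -, -, -,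
    -, h1_9, h1_10, -, h2_11, h2_12, -, h3_9, h3_11, -, h4_10, h4_12⟩
  have hli12 : LinearIndependent F ![m₁, m₂] := by
    convert hli.comp ![0, 1] (by decide) using 1
    ext i; fin_cases i <;> rfl
  have hli34 : LinearIndependent F ![m₃, m₄] := by
    convert hli.comp ![2, 3] (by decide) using 1
    ext i; fin_cases i <;> rfl
  have hdisj : Disjoint (span F {m₁, m₂}) (span F {m₃, m₄}) := by
    simpa [Set.image_pair] using hli.disjoint_span_image
      (s := {0, 1}) (t := {2, 3}) (by simp)
  have key : ∀ {x y z : W}, x ∈ span F {m₃, m₄} → x ∉ span F {m₈} →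
      x ∈ span F {m₈, y} → x ∈ span F {m₈, z} →
      m₁ ∈ span F {m₅, y} → m₂ ∈ span F {m₅, z} → False := by
    intro x y z hx hx8 hxy hxz h1 h2
    exact hli12.notMem_span_singleton_of_pair
      (mem_span_singleton_of_mem_span_pair_of_disjoint hdisj h5 (mem_span_of_mem (by simp))
        (mem_of_mem_span_pair_of_notMem h8 hx hxy hx8) h1)
      (mem_span_singleton_of_mem_span_pair_of_disjoint hdisj h5 (mem_span_of_mem (by simp))
        (mem_of_mem_span_pair_of_notMem h8 hx hxz hx8) h2)
  by_cases h3 : m₃ ∈ span F {m₈}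
  · exact key (mem_span_of_mem (by simp)) (hli34.notMem_span_singleton_of_pair h3)
      h4_10 h4_12 h1_10 h2_12
  · exact key (mem_span_of_mem (by simp)) h3 h3_9 h3_11 h1_9 h2_11
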